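/- The two formulas for the superdeterminant agree: Let M = [[A, C],[D, B]] be an even (m|n) supermatrix over Λ and assume that A and B are invertible as matrices over the commutative ring Λ_ev (equivalently, their body matrices π_B(A) and π_B(B) are invertible scalar matrices). Then the matrices B − D A^{-1} C and A − C B^{-1} D, whose entries lie in Λ_ev, are invertible, and det A · (det(B − D A^{-1} C))^{-1} = det(A − C B^{-1} D) · (det B)^{-1}; this common value is sdet M. -/

import Mathlib

set_option synthInstance.maxHeartbeats 1000000
set_option maxHeartbeats 2000000

noncomputable section

/-- `Λ`: the (complexified) Grassmann algebra on `L` generators. -/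
abbrev Lam (L : ℕ) : Type := ExteriorAlgebra ℂ (Fin L → ℂ)

variable (L : ℕ)

/-- The even part `Λ_ev`. -/
def evenPart : Submodule ℂ (Lam L) :=
  CliffordAlgebra.evenOdd (0 : QuadraticForm ℂ (Fin L → ℂ)) 0

/-- The odd part `Λ_od`. -/
def oddPart : Submodule ℂ (Lam L) :=
  CliffordAlgebra.evenOdd (0 : QuadraticForm ℂ (Fin L → ℂ)) 1

/-- Determinant of a square matrix with entries in `Λ` (intended for matrices whose entries
are even, hence central), as the signed sum over permutations of ordered products. -/
def detE {k : ℕ} (M : Matrix (Fin k) (Fin k) (Lam L)) : Lam L :=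
  ∑ σ : Equiv.Perm (Fin k), (Equiv.Perm.sign σ : ℤ) • (List.ofFn fun i => M (σ i) i).prod

section OddMatrices

variable {R S : Type*} [CommRing R] [Ring S]

/-- `O` behaves like the odd part of a supercommutative ring `S` whose even part is the image of
the injective ring homomorphism `f`. -/
structure IsOddPart (f : R →+* S) (O : AddSubgroup S) : Prop where
  injective : Function.Injective f
  exists_eq_mul : ∀ {x y}, x ∈ O → y ∈ O → ∃ r, f r = x * y
  map_mul_mem : ∀ r {x}, x ∈ O → f r * x ∈ O
  mul_comm_neg : ∀ {x y}, x ∈ O → y ∈ O → x * y = -(y * x)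
  mul_self : ∀ {x}, x ∈ O → x * x = 0

/-- For all matrices `P`, `Q` with odd entries, `det (1 - P * Q) * det (1 - Q * P) = 1`. -/
def OddDetReciprocal (f : R →+* S) (O : AddSubgroup S) (m n : Type*) [Fintype m] [Fintype n]
    [DecidableEq m] [DecidableEq n] : Prop :=
  ∀ (P : Matrix m n S) (Q : Matrix n m S), (∀ i j, P i j ∈ O) → (∀ i j, Q i j ∈ O) →
    ∀ (U : Matrix m m R) (V : Matrix n n R), U.map f = 1 - P * Q → V.map f = 1 - Q * P →
      U.det * V.det = 1

namespace IsOddPart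

variable {f : R →+* S} {O : AddSubgroup S}

theorem exists_map_eq_mul (h : IsOddPart f O) {l m n : Type*} [Fintype m]
    {P : Matrix l m S} {Q : Matrix m n S} (hP : ∀ i j, P i j ∈ O) (hQ : ∀ i j, Q i j ∈ O) :
    ∃ U : Matrix l n R, U.map f = P * Q := by
  choose r hr using fun i j k => h.exists_eq_mul (hP i j) (hQ j k)
  refine ⟨Matrix.of fun i k => ∑ j, r i j k, ?_⟩
  ext i k
  simp [Matrix.mul_apply, hr]

theorem exists_map_eq_one_sub_mul (h : IsOddPart f O) {m n : Type*} [Fintype n] [DecidableEq m]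
    {P : Matrix m n S} {Q : Matrix n m S} (hP : ∀ i j, P i j ∈ O) (hQ : ∀ i j, Q i j ∈ O) :
    ∃ U : Matrix m m R, U.map f = 1 - P * Q := by
  obtain ⟨W, hW⟩ := h.exists_map_eq_mul hP hQ
  refine ⟨1 - W, ?_⟩
  rw [Matrix.map_sub f (map_sub f), hW, Matrix.map_one f (map_zero f) (map_one f)]

theorem map_matrix_mul_mem (h : IsOddPart f O) {l m n : Type*} [Fintype m]
    (U : Matrix l m R) {P : Matrix m n S} (hP : ∀ i j, P i j ∈ O) (i : l) (j : n) :
    (U.map f * P) i j ∈ O := by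
  rw [Matrix.mul_apply]
  exact O.sum_mem fun k _ => h.map_mul_mem _ (hP k j)

end IsOddPart

namespace OddDetReciprocal

variable {f : R →+* S} {O : AddSubgroup S} {m n a b : Type*} [Fintype m] [Fintype n]
  [Fintype a] [Fintype b] [DecidableEq m] [DecidableEq n] [DecidableEq a] [DecidableEq b]

theorem symm (h : OddDetReciprocal f O m n) : OddDetReciprocal f O n m :=
  fun P Q hP hQ U V hU hV => by rw [mul_comm, h Q P hQ hP V U hV hU]

theorem congr_right (e : a ≃ n) (h : OddDetReciprocal f O m a) : OddDetReciprocal f O m n := by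
  intro P Q hP hQ U V hU hV
  rw [← Matrix.det_submatrix_equiv_self e V]
  refine h (P.submatrix id e) (Q.submatrix e id) (fun _ _ => hP _ _) (fun _ _ => hQ _ _) _ _ ?_ ?_
  · rw [Matrix.submatrix_mul_equiv, hU, Matrix.submatrix_id_id]
  · rw [← Matrix.submatrix_map, hV, Matrix.submatrix_sub, Pi.sub_apply, Pi.sub_apply,
      Matrix.submatrix_one_equiv, Matrix.submatrix_mul Q P e id e Function.bijective_id]

theorem of_isEmpty (hf : Function.Injective f) [IsEmpty n] : OddDetReciprocal f O m n := by
  intro P Q _ _ U V hU _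
  have : U = 1 := by
    apply Matrix.map_injective hf
    beta_reduce
    rw [hU, Matrix.map_one f (map_zero f) (map_one f)]
    ext i j
    simp [Matrix.mul_apply]
  simp [this]

theorem of_unique (h : IsOddPart f O) [Unique m] [Unique n] : OddDetReciprocal f O m n := by
  intro P Q hP hQ U V hU hV
  rw [Matrix.det_unique, Matrix.det_unique]
  apply h.injective
  have hu := congrFun₂ hU default default
  have hv := congrFun₂ hV default default
  simp only [Matrix.map_apply, Matrix.sub_apply, Matrix.one_apply_eq, Matrix.mul_apply,
    Fintype.sum_unique] at hu hv
  rw [map_mul, map_one, hu, hv]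
  have hp := hP default default
  have hq := hQ default default
  generalize P default default = p at hp
  generalize Q default default = q at hq
  have hpq : p * q * (p * q) = 0 := by
    rw [mul_assoc, ← mul_assoc q, h.mul_comm_neg hq hp, neg_mul, mul_assoc, h.mul_self hq,
      mul_zero, neg_zero, mul_zero]
  rw [h.mul_comm_neg hq hp, sub_neg_eq_add, mul_add, sub_mul, sub_mul, hpq]
  simp

theorem sum_right (h : IsOddPart f O) (ha : OddDetReciprocal f O m a)
    (hb : OddDetReciprocal f O m b) : OddDetReciprocal f O m (a ⊕ b) := by
  intro P Q hP hQ U V hU hV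
  obtain ⟨P₁, P₂, rfl⟩ : ∃ P₁ P₂, P = Matrix.fromCols P₁ P₂ := ⟨_, _, (P.fromCols_toCols).symm⟩
  obtain ⟨Q₁, Q₂, rfl⟩ : ∃ Q₁ Q₂, Q = Matrix.fromRows Q₁ Q₂ := ⟨_, _, (Q.fromRows_toRows).symm⟩
  have hP₁ : ∀ i j, P₁ i j ∈ O := fun i j => hP i (.inl j)
  have hP₂ : ∀ i j, P₂ i j ∈ O := fun i j => hP i (.inr j)
  have hQ₁ : ∀ i j, Q₁ i j ∈ O := fun i j => hQ (.inl i) j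
  have hQ₂ : ∀ i j, Q₂ i j ∈ O := fun i j => hQ (.inr i) j
  obtain ⟨U₁, hU₁⟩ := h.exists_map_eq_one_sub_mul hP₁ hQ₁
  obtain ⟨V₁, hV₁⟩ := h.exists_map_eq_one_sub_mul hQ₁ hP₁
  have hdet₁ := ha P₁ Q₁ hP₁ hQ₁ U₁ V₁ hU₁ hV₁
  have hU₁u : IsUnit U₁.det := .of_mul_eq_one _ hdet₁
  have hV₁u : IsUnit V₁.det := .of_mul_eq_one_right _ hdet₁
  set W := U₁⁻¹.map f with hW
  have hUW : U₁.map f * W = 1 := by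
    rw [hW, ← Matrix.map_mul, Matrix.mul_nonsing_inv _ hU₁u,
      Matrix.map_one f (map_zero f) (map_one f)]
  have hWU : W * U₁.map f = 1 := by
    rw [hW, ← Matrix.map_mul, Matrix.nonsing_inv_mul _ hU₁u,
      Matrix.map_one f (map_zero f) (map_one f)]
  have hVV : V₁.map f * V₁⁻¹.map f = 1 := by
    rw [← Matrix.map_mul, Matrix.mul_nonsing_inv _ hV₁u, Matrix.map_one f (map_zero f) (map_one f)]
  have hWP₂ := h.map_matrix_mul_mem U₁⁻¹ hP₂
  obtain ⟨U₂, hU₂⟩ := h.exists_map_eq_one_sub_mul hWP₂ hQ₂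
  obtain ⟨V₂, hV₂⟩ := h.exists_map_eq_one_sub_mul hQ₂ hWP₂
  have hdet₂ := hb _ Q₂ hWP₂ hQ₂ U₂ V₂ hU₂ hV₂
  have hUeq : U = U₁ * U₂ := by
    apply Matrix.map_injective h.injective
    beta_reduce
    rw [Matrix.map_mul, hU, hU₂, Matrix.fromCols_mul_fromRows, Matrix.mul_sub, Matrix.mul_one,
      ← Matrix.mul_assoc, ← Matrix.mul_assoc, hUW, Matrix.one_mul, hU₁]
    abel
  have hcomm : U₁.map f * P₁ = P₁ * V₁.map f := by
    rw [hU₁, hV₁, Matrix.sub_mul, Matrix.mul_sub, Matrix.one_mul, Matrix.mul_one, Matrix.mul_assoc]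
  have hpush : P₁ * V₁⁻¹.map f = W * P₁ := by
    calc P₁ * V₁⁻¹.map f = W * (U₁.map f * P₁) * V₁⁻¹.map f := by
          rw [← Matrix.mul_assoc W, hWU, Matrix.one_mul]
      _ = W * P₁ * (V₁.map f * V₁⁻¹.map f) := by rw [hcomm]; simp only [Matrix.mul_assoc]
      _ = W * P₁ := by rw [hVV, Matrix.mul_one]
  have hWeq : W * (P₁ * Q₁) = W - 1 := by
    have : P₁ * Q₁ = 1 - U₁.map f := by rw [hU₁]; abel
    rw [this, Matrix.mul_sub, hWU, Matrix.mul_one]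
  have hVb : V.map f =
      Matrix.fromBlocks (1 - Q₁ * P₁) (-(Q₁ * P₂)) (-(Q₂ * P₁)) (1 - Q₂ * P₂) := by
    rw [hV, Matrix.fromRows_mul_fromCols, ← Matrix.fromBlocks_one, sub_eq_add_neg,
      Matrix.fromBlocks_neg, Matrix.fromBlocks_add]
    simp [sub_eq_add_neg]
  have hVeq : V = Matrix.fromBlocks V₁ V.toBlocks₁₂ V.toBlocks₂₁ V.toBlocks₂₂ := by
    have : V.toBlocks₁₁ = V₁ := by
      apply Matrix.map_injective h.injective
      beta_reduce
      rw [hV₁]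
      exact congrArg Matrix.toBlocks₁₁ hVb
    rw [← this, Matrix.fromBlocks_toBlocks]
  have h₁₂ : V.toBlocks₁₂.map f = -(Q₁ * P₂) := congrArg Matrix.toBlocks₁₂ hVb
  have h₂₁ : V.toBlocks₂₁.map f = -(Q₂ * P₁) := congrArg Matrix.toBlocks₂₁ hVb
  have h₂₂ : V.toBlocks₂₂.map f = 1 - Q₂ * P₂ := congrArg Matrix.toBlocks₂₂ hVb
  let : Invertible V₁ := V₁.invertibleOfIsUnitDet hV₁u
  have hSchur : V.toBlocks₂₂ - V.toBlocks₂₁ * ⅟V₁ * V.toBlocks₁₂ = V₂ := by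
    apply Matrix.map_injective h.injective
    beta_reduce
    rw [Matrix.invOf_eq_nonsing_inv, Matrix.map_sub f (map_sub f), Matrix.map_mul, Matrix.map_mul,
      h₁₂, h₂₁, h₂₂, hV₂]
    calc 1 - Q₂ * P₂ - -(Q₂ * P₁) * V₁⁻¹.map f * -(Q₁ * P₂)
        = 1 - Q₂ * P₂ - Q₂ * (P₁ * V₁⁻¹.map f) * (Q₁ * P₂) := by
          simp only [Matrix.neg_mul, Matrix.mul_neg, neg_neg, Matrix.mul_assoc]
      _ = 1 - Q₂ * P₂ - Q₂ * ((W * (P₁ * Q₁)) * P₂) := by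
          rw [hpush]; simp only [Matrix.mul_assoc]
      _ = 1 - Q₂ * (W * P₂) := by
          rw [hWeq, Matrix.sub_mul, Matrix.one_mul, Matrix.mul_sub]; abel
  rw [hVeq, Matrix.det_fromBlocks₁₁, hSchur, hUeq, Matrix.det_mul]
  calc U₁.det * U₂.det * (V₁.det * V₂.det) = (U₁.det * V₁.det) * (U₂.det * V₂.det) := by ring
    _ = 1 := by rw [hdet₁, hdet₂, mul_one]

theorem fin_of_fin_one (h : IsOddPart f O) (h₁ : OddDetReciprocal f O m (Fin 1)) (k : ℕ) :
    OddDetReciprocal f O m (Fin k) := by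
  induction k with
  | zero => exact of_isEmpty h.injective
  | succ k ih => exact (ih.sum_right h h₁).congr_right finSumFinEquiv

end OddDetReciprocal

theorem IsOddPart.oddDetReciprocal {f : R →+* S} {O : AddSubgroup S} (h : IsOddPart f O)
    (k l : ℕ) : OddDetReciprocal f O (Fin k) (Fin l) :=
  .fin_of_fin_one h (OddDetReciprocal.fin_of_fin_one h (.of_unique h) k).symm l

end OddMatrices

section Supercommutativity

variable {L}

theorem ι_mul_of_mem_evenPart (v : Fin L → ℂ) {x : Lam L} (hx : x ∈ evenPart L) :
    ExteriorAlgebra.ι ℂ v * x = x * ExteriorAlgebra.ι ℂ v := by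
  induction x, hx using CliffordAlgebra.even_induction with
  | algebraMap r => exact (Algebra.commutes r _).symm
  | add x y _ _ ihx ihy => rw [mul_add, add_mul, ihx, ihy]
  | ι_mul_ι_mul m₁ m₂ x _ ih =>
    have swap (a b : Fin L → ℂ) : ExteriorAlgebra.ι ℂ a * ExteriorAlgebra.ι ℂ b =
        -(ExteriorAlgebra.ι ℂ b * ExteriorAlgebra.ι ℂ a) :=
      eq_neg_of_add_eq_zero_left (ExteriorAlgebra.ι_add_mul_swap a b)
    change ExteriorAlgebra.ι ℂ v * (ExteriorAlgebra.ι ℂ m₁ * ExteriorAlgebra.ι ℂ m₂ * x) =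
      ExteriorAlgebra.ι ℂ m₁ * ExteriorAlgebra.ι ℂ m₂ * x * ExteriorAlgebra.ι ℂ v
    rw [mul_assoc _ x, ← ih, ← mul_assoc, ← mul_assoc, ← mul_assoc, swap v m₁, neg_mul,
      mul_assoc (ExteriorAlgebra.ι ℂ m₁), swap v m₂, mul_neg, neg_neg, ← mul_assoc]

theorem commute_of_mem_evenPart {x : Lam L} (hx : x ∈ evenPart L) (y : Lam L) : x * y = y * x := by
  induction y using CliffordAlgebra.induction with
  | algebraMap r => exact (Algebra.commutes r _).symm
  | ι v => exact (ι_mul_of_mem_evenPart v hx).symm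
  | mul a b iha ihb => rw [← mul_assoc, iha, mul_assoc, ihb, mul_assoc]
  | add a b iha ihb => rw [mul_add, add_mul, iha, ihb]

theorem even_mul_odd_mem_oddPart {x y : Lam L} (hx : x ∈ evenPart L) (hy : y ∈ oddPart L) :
    x * y ∈ oddPart L :=
  CliffordAlgebra.evenOdd_mul_le _ 0 1 (Submodule.mul_mem_mul hx hy)

theorem odd_mul_odd_mem_evenPart {x y : Lam L} (hx : x ∈ oddPart L) (hy : y ∈ oddPart L) :
    x * y ∈ evenPart L :=
  CliffordAlgebra.evenOdd_mul_le _ 1 1 (Submodule.mul_mem_mul hx hy)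

theorem ι_mul_of_mem_oddPart (v : Fin L → ℂ) {x : Lam L} (hx : x ∈ oddPart L) :
    ExteriorAlgebra.ι ℂ v * x = -(x * ExteriorAlgebra.ι ℂ v) := by
  induction x, hx using CliffordAlgebra.odd_induction with
  | ι w => exact eq_neg_of_add_eq_zero_left (ExteriorAlgebra.ι_add_mul_swap v w)
  | add x y _ _ ihx ihy => rw [mul_add, add_mul, ihx, ihy, neg_add]
  | ι_mul_ι_mul m₁ m₂ x _ ih =>
    have he := commute_of_mem_evenPart (CliffordAlgebra.ι_mul_ι_mem_evenOdd_zero _ m₁ m₂)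
      (ExteriorAlgebra.ι ℂ v)
    rw [← mul_assoc, ← he, mul_assoc, ih, mul_neg, mul_assoc, mul_assoc, mul_assoc]

theorem mul_eq_neg_of_mem_oddPart {x y : Lam L} (hx : x ∈ oddPart L) (hy : y ∈ oddPart L) :
    x * y = -(y * x) := by
  induction x, hx using CliffordAlgebra.odd_induction with
  | ι w => exact ι_mul_of_mem_oddPart w hy
  | add a b _ _ iha ihb => rw [mul_add, add_mul, iha, ihb, neg_add]
  | ι_mul_ι_mul m₁ m₂ x _ ih =>
    have he := commute_of_mem_evenPart (CliffordAlgebra.ι_mul_ι_mem_evenOdd_zero _ m₁ m₂) y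
    rw [mul_assoc, ih, mul_neg, ← mul_assoc, he, mul_assoc]

variable (L) in
/-- The even part of `Λ` as a commutative ring. -/
abbrev EvenRing : Type := CliffordAlgebra.even (0 : QuadraticForm ℂ (Fin L → ℂ))

instance : CommRing (EvenRing L) where
  mul_comm x y := Subtype.ext (commute_of_mem_evenPart x.2 y.1)

variable (L) in
/-- The inclusion of the even part in `Λ`. -/
def evenIncl : EvenRing L →+* Lam L where
  toFun := Subtype.val
  map_one' := rfl
  map_mul' _ _ := rfl
  map_zero' := rfl
  map_add' _ _ := rfl

theorem isOddPart_oddPart : IsOddPart (evenIncl L) (oddPart L).toAddSubgroup where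
  injective := Subtype.val_injective
  exists_eq_mul hx hy := ⟨⟨_, odd_mul_odd_mem_evenPart hx hy⟩, rfl⟩
  map_mul_mem r _ hx := even_mul_odd_mem_oddPart r.2 hx
  mul_comm_neg := mul_eq_neg_of_mem_oddPart
  mul_self hx := by
    refine (smul_eq_zero_iff_right (two_ne_zero' ℂ)).mp ?_
    rw [two_smul]
    exact add_eq_zero_iff_eq_neg.mpr (mul_eq_neg_of_mem_oddPart hx hx)

theorem detE_map_evenIncl {k : ℕ} (M : Matrix (Fin k) (Fin k) (EvenRing L)) :
    detE L (M.map (evenIncl L)) = evenIncl L M.det := by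
  rw [detE, Matrix.det_apply, map_sum]
  refine Finset.sum_congr rfl fun σ _ => ?_
  rw [Units.smul_def, map_zsmul, ← List.prod_ofFn, map_list_prod, List.map_ofFn]
  rfl

theorem exists_map_evenIncl {k l : ℕ} {M : Matrix (Fin k) (Fin l) (Lam L)}
    (hM : ∀ i j, M i j ∈ evenPart L) :
    ∃ N : Matrix (Fin k) (Fin l) (EvenRing L), N.map (evenIncl L) = M :=
  ⟨Matrix.of fun i j => ⟨M i j, hM i j⟩, rfl⟩

end Supercommutativity

/-- **The two formulas for the superdeterminant agree.**
Let `M = [[A, C],[D, B]]` be an even `(m|n)` supermatrix over `Λ` (entries of `A`, `B` even,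
entries of `C`, `D` odd) and assume `A` and `B` are invertible over `Λ_ev` (two-sided inverse
matrices `A'`, `B'` with even entries).  Then the Schur complements `B − D A⁻¹ C` and
`A − C B⁻¹ D` have entries in `Λ_ev` and are invertible (over `Λ_ev`), and
`det A · (det(B − D A⁻¹ C))⁻¹ = det(A − C B⁻¹ D) · (det B)⁻¹`, where the determinant inverses
are the (two-sided, unique) inverses `d₁` of `det (B − D A⁻¹ C)` and `d₂` of `det B`. -/
theorem sdet_two_formulas_agree (m n : ℕ)
    (A : Matrix (Fin m) (Fin m) (Lam L)) (B : Matrix (Fin n) (Fin n) (Lam L))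
    (C : Matrix (Fin m) (Fin n) (Lam L)) (D : Matrix (Fin n) (Fin m) (Lam L))
    (hA : ∀ i j, A i j ∈ evenPart L) (hB : ∀ i j, B i j ∈ evenPart L)
    (hC : ∀ i j, C i j ∈ oddPart L) (hD : ∀ i j, D i j ∈ oddPart L)
    (A' : Matrix (Fin m) (Fin m) (Lam L)) (hA' : ∀ i j, A' i j ∈ evenPart L)
    (hAA' : A * A' = 1) (hA'A : A' * A = 1)
    (B' : Matrix (Fin n) (Fin n) (Lam L)) (hB' : ∀ i j, B' i j ∈ evenPart L)
    (hBB' : B * B' = 1) (hB'B : B' * B = 1) :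
    (∀ i j, (B - D * A' * C) i j ∈ evenPart L) ∧
    (∀ i j, (A - C * B' * D) i j ∈ evenPart L) ∧
    (∃ X : Matrix (Fin n) (Fin n) (Lam L), (∀ i j, X i j ∈ evenPart L) ∧
      (B - D * A' * C) * X = 1 ∧ X * (B - D * A' * C) = 1) ∧
    (∃ Y : Matrix (Fin m) (Fin m) (Lam L), (∀ i j, Y i j ∈ evenPart L) ∧
      (A - C * B' * D) * Y = 1 ∧ Y * (A - C * B' * D) = 1) ∧
    (∃ d₁ d₂ : Lam L,
      detE L (B - D * A' * C) * d₁ = 1 ∧ d₁ * detE L (B - D * A' * C) = 1 ∧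
      detE L B * d₂ = 1 ∧ d₂ * detE L B = 1 ∧
      detE L A * d₁ = detE L (A - C * B' * D) * d₂) := by
  obtain ⟨A, rfl⟩ := exists_map_evenIncl hA
  obtain ⟨A', rfl⟩ := exists_map_evenIncl hA'
  obtain ⟨B, rfl⟩ := exists_map_evenIncl hB
  obtain ⟨B', rfl⟩ := exists_map_evenIncl hB'
  have hodd := isOddPart_oddPart (L := L)
  have hP := hodd.map_matrix_mul_mem A' hC
  have hQ := hodd.map_matrix_mul_mem B' hD
  obtain ⟨U, hU⟩ := hodd.exists_map_eq_one_sub_mul hP hQ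
  obtain ⟨V, hV⟩ := hodd.exists_map_eq_one_sub_mul hQ hP
  have hUV : U.det * V.det = 1 := hodd.oddDetReciprocal m n _ _ hP hQ U V hU hV
  have hSB : B.map (evenIncl L) - D * A'.map (evenIncl L) * C = (B * V).map (evenIncl L) := by
    rw [Matrix.map_mul, hV, Matrix.mul_sub, Matrix.mul_one, ← Matrix.mul_assoc, ← Matrix.mul_assoc,
      ← Matrix.mul_assoc, hBB', Matrix.one_mul]
  have hSA : A.map (evenIncl L) - C * B'.map (evenIncl L) * D = (A * U).map (evenIncl L) := by
    rw [Matrix.map_mul, hU, Matrix.mul_sub, Matrix.mul_one, ← Matrix.mul_assoc, ← Matrix.mul_assoc,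
      ← Matrix.mul_assoc, hAA', Matrix.one_mul]
  have map_one {k : ℕ} : (1 : Matrix (Fin k) (Fin k) (EvenRing L)).map (evenIncl L) = 1 :=
    Matrix.map_one _ (map_zero _) (map_one _)
  have hA₁ : A.det * A'.det = 1 := by
    rw [← Matrix.det_mul, Matrix.map_injective hodd.injective
      ((Matrix.map_mul.trans hAA').trans map_one.symm), Matrix.det_one]
  have hB₁ : B.det * B'.det = 1 := by
    rw [← Matrix.det_mul, Matrix.map_injective hodd.injective
      ((Matrix.map_mul.trans hBB').trans map_one.symm), Matrix.det_one]
  have hBV : (B * V).det * (U.det * B'.det) = 1 := by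
    rw [Matrix.det_mul]; linear_combination hUV + U.det * V.det * hB₁
  have hAU : (A * U).det * (V.det * A'.det) = 1 := by
    rw [Matrix.det_mul]; linear_combination hUV + U.det * V.det * hA₁
  have hBVu : IsUnit (B * V).det := .of_mul_eq_one _ hBV
  have hAUu : IsUnit (A * U).det := .of_mul_eq_one _ hAU
  rw [hSB, hSA]
  refine ⟨fun i j => ((B * V) i j).2, fun i j => ((A * U) i j).2,
    ⟨(B * V)⁻¹.map (evenIncl L), fun i j => ((B * V)⁻¹ i j).2, ?_, ?_⟩,
    ⟨(A * U)⁻¹.map (evenIncl L), fun i j => ((A * U)⁻¹ i j).2, ?_, ?_⟩,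
    evenIncl L (U.det * B'.det), evenIncl L B'.det, ?_⟩
  · rw [← Matrix.map_mul, Matrix.mul_nonsing_inv _ hBVu, map_one]
  · rw [← Matrix.map_mul, Matrix.nonsing_inv_mul _ hBVu, map_one]
  · rw [← Matrix.map_mul, Matrix.mul_nonsing_inv _ hAUu, map_one]
  · rw [← Matrix.map_mul, Matrix.nonsing_inv_mul _ hAUu, map_one]
  simp only [detE_map_evenIncl, ← map_mul]
  refine ⟨?_, ?_, ?_, ?_, ?_⟩
  · rw [hBV, _root_.map_one]
  · rw [mul_comm, hBV, _root_.map_one]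
  · rw [hB₁, _root_.map_one]
  · rw [mul_comm, hB₁, _root_.map_one]
  · rw [Matrix.det_mul, mul_assoc]
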